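/- Suppose |V| = |R × S| and K_1 is invertible. The inverse Born series Σ_{j=1}^∞ 𝒦_j(φ, …, φ) converges absolutely whenever ‖𝒦_1 φ‖_{ℓ^p} < (1/μ_p)·[1 − (2ν_p/C_p)(√(1 + C_p/ν_p) − 1)], and its sum η satisfies Σ_{j=1}^∞ K_j(η, …, η) = φ. -/

import Mathlib

open scoped ENNReal

/-- The ℓ^p norm of a finitely indexed family, `p ∈ [1, ∞]`. -/
noncomputable def lpNorm (p : ℝ≥0∞) {ι E : Type*} [Fintype ι] [SeminormedAddCommGroup E]
    (f : ι → E) : ℝ :=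
  if p = ∞ then ⨆ i, ‖f i‖ else (∑ i, ‖f i‖ ^ p.toReal) ^ (1 / p.toReal)

variable {V R S : Type*} [Fintype V] [DecidableEq V] [Fintype R] [Fintype S]

/-- The multilinear forward Born operator: `bornK α0 B G C j` is `K_j`, mapping
`(η_1, …, η_j)` (given as the first `j` values of an `ℕ`-indexed family) to
`(r, s) ↦ (−α0)^j (B D_{η_1} G D_{η_2} G ⋯ G D_{η_j} C)(r, s)`; `K_0 := 0` is junk. -/
noncomputable def bornK (α0 : ℝ) (B : Matrix R V ℂ) (G : Matrix V V ℂ) (C : Matrix V S ℂ) :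
    ℕ → (ℕ → V → ℂ) → R × S → ℂ
  | 0, _ => 0
  | j + 1, η => fun rs =>
      (-(α0 : ℂ)) ^ (j + 1) *
        (B * Matrix.diagonal (η 0) *
          (List.ofFn fun i : Fin j => G * Matrix.diagonal (η (i.1 + 1))).prod * C) rs.1 rs.2

/-- `μ_p = α0 · max_{v ∈ V} ‖row v of G‖_{ℓ^q}` (this depends only on `q`). -/
noncomputable def muConst (α0 : ℝ) (q : ℝ≥0∞) (G : Matrix V V ℂ) : ℝ :=
  α0 * ⨆ v : V, lpNorm q (G v)

/-- `ν_p = α0 · (Σ_{r ∈ R} ‖row r of B‖_q^p)^{1/p} · (Σ_{s ∈ S} ‖column s of C‖_q^p)^{1/p}`,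
with maxima replacing sums when `p = ∞`. -/
noncomputable def nuConst (α0 : ℝ) (p q : ℝ≥0∞) (B : Matrix R V ℂ) (C : Matrix V S ℂ) : ℝ :=
  α0 * lpNorm p (fun r : R => lpNorm q (B r)) * lpNorm p (fun s : S => lpNorm q fun v => C v s)

/-- `C_p = min_{‖η‖_p = 1} ‖K_1 η‖_p`. -/
noncomputable def CpConst (p : ℝ≥0∞) (α0 : ℝ) (B : Matrix R V ℂ) (G : Matrix V V ℂ)
    (C : Matrix V S ℂ) : ℝ :=
  sInf {t : ℝ | ∃ η : V → ℂ, lpNorm p η = 1 ∧ t = lpNorm p (bornK α0 B G C 1 fun _ => η)}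

/-- Block application for the tensor sum over compositions: given a composition `c` of `j`
and arguments `x : (ℂ^V)^j` (as an `ℕ`-indexed family), `blockK c x` is the `m`-tuple
`(K_{i_1} ⊗ ⋯ ⊗ K_{i_m})(x_1, …, x_j)`, where `m = c.length`, `i_k = c.blocksFun k`, and the
`k`-th component applies `K_{i_k}` to the consecutive block of arguments of size `i_k`. -/
noncomputable def blockK (α0 : ℝ) (B : Matrix R V ℂ) (G : Matrix V V ℂ) (C : Matrix V S ℂ)
    {j : ℕ} (c : Composition j) (x : ℕ → V → ℂ) : ℕ → R × S → ℂ :=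
  fun k =>
    if h : k < c.length then
      bornK α0 B G C (c.blocksFun ⟨k, h⟩) (fun i => x (c.sizeUpTo k + i))
    else 0

/-- The multilinear inverse Born operators: `bornKinv α0 B G C 𝒦₁ j` is `𝒦_j`, where
`𝒦_1 = 𝒦₁` (intended to be `K_1⁻¹`) and, for `j ≥ 2`,
`𝒦_j = −(Σ_{m=1}^{j−1} 𝒦_m ∘ (Σ_{i_1+⋯+i_m=j, i_k ≥ 1} K_{i_1} ⊗ ⋯ ⊗ K_{i_m})) ∘ (𝒦_1 ⊗ ⋯ ⊗ 𝒦_1)`;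
the inner sum over `m` and over `(i_1, …, i_m)` is the sum over all compositions `c` of `j`
with `c.length = m < j`. `𝒦_0 := 0` is junk. -/
noncomputable def bornKinv (α0 : ℝ) (B : Matrix R V ℂ) (G : Matrix V V ℂ) (C : Matrix V S ℂ)
    (K1inv : (R × S → ℂ) → V → ℂ) : ℕ → (ℕ → R × S → ℂ) → V → ℂ
  | 0 => fun _ => 0
  | 1 => fun x => K1inv (x 0)
  | j + 2 => fun x =>
      -∑ c : Composition (j + 2),
        if h : c.length < j + 2 then
          bornKinv α0 B G C K1inv c.length (blockK α0 B G C c fun i => K1inv (x i))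
        else 0
  termination_by j => j
  decreasing_by exact h

/-- The multilinear operator norm `‖T‖_p` of a `j`-multilinear map `T` (taking its arguments
as an `ℕ`-indexed family, only the first `j` of which matter): the smallest constant `t` with
`‖T(x_1, …, x_j)‖_p ≤ t ∏_{i=1}^j ‖x_i‖_p` for all `x`. -/
noncomputable def mulNorm (p : ℝ≥0∞) (j : ℕ) (T : (ℕ → R × S → ℂ) → V → ℂ) : ℝ :=
  sInf {t : ℝ | ∀ x : ℕ → R × S → ℂ, lpNorm p (T x) ≤ t * ∏ i ∈ Finset.range j, lpNorm p (x i)}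

section LpNorm

variable {ι κ E : Type*} [Fintype ι] [Fintype κ] [SeminormedAddCommGroup E]

theorem lpNorm_eq_norm_toLp {p : ℝ≥0∞} (hp : 1 ≤ p) (f : ι → E) :
    lpNorm p f = ‖WithLp.toLp p f‖ := by
  have : Fact (1 ≤ p) := ⟨hp⟩
  unfold lpNorm
  split_ifs with h
  · subst h
    rw [PiLp.norm_eq_ciSup]
  · rw [PiLp.norm_eq_sum (ENNReal.toReal_pos (by positivity) h)]

theorem lpNorm_nonneg (p : ℝ≥0∞) (f : ι → E) : 0 ≤ lpNorm p f := by
  unfold lpNorm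
  split_ifs
  · exact Real.iSup_nonneg fun i => norm_nonneg _
  · positivity

theorem norm_le_lpNorm {p : ℝ≥0∞} (hp : 1 ≤ p) (f : ι → E) (i : ι) : ‖f i‖ ≤ lpNorm p f := by
  have : Fact (1 ≤ p) := ⟨hp⟩
  rw [lpNorm_eq_norm_toLp hp]
  exact PiLp.norm_apply_le (WithLp.toLp p f) i

theorem lpNorm_one (f : ι → E) : lpNorm 1 f = ∑ i, ‖f i‖ := by
  simp [lpNorm]

/-- Hölder's inequality for conjugate exponents in `[1, ∞]`. -/
theorem sum_norm_mul_norm_le_lpNorm {p q : ℝ≥0∞} (hp : 1 ≤ p) (hq : 1 ≤ q)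
    (hpq : 1 / p + 1 / q = 1) (f g : ι → E) :
    ∑ i, ‖f i‖ * ‖g i‖ ≤ lpNorm q f * lpNorm p g := by
  simp only [one_div] at hpq
  by_cases hptop : p = ∞
  · have hq1 : q = 1 := by simpa [hptop] using hpq
    subst hq1
    rw [lpNorm_one, Finset.sum_mul]
    gcongr with i
    exact norm_le_lpNorm hp g i
  by_cases hqtop : q = ∞
  · have hp1 : p = 1 := by simpa [hqtop] using hpq
    subst hp1
    rw [lpNorm_one, Finset.mul_sum]
    gcongr with i
    exact norm_le_lpNorm hq f i
  have hpq' : q.toReal.HolderConjugate p.toReal := by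
    have hp0 : p ≠ 0 := (zero_lt_one.trans_le hp).ne'
    have hq0 : q ≠ 0 := (zero_lt_one.trans_le hq).ne'
    refine ⟨?_, ENNReal.toReal_pos hq0 hqtop, ENNReal.toReal_pos hp0 hptop⟩
    rw [← ENNReal.toReal_inv, ← ENNReal.toReal_inv,
      ← ENNReal.toReal_add (by simpa using hq0) (by simpa using hp0), add_comm, hpq]
    simp
  simpa [lpNorm, hptop, hqtop] using Real.inner_le_Lp_mul_Lq_of_nonneg Finset.univ hpq'
    (f := fun i => ‖f i‖) (g := fun i => ‖g i‖) (fun _ _ => norm_nonneg _) fun _ _ => norm_nonneg _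

theorem lpNorm_prod_le {p : ℝ≥0∞} (hp : 1 ≤ p) {a : ι → ℝ} {b : κ → ℝ} (ha : ∀ i, 0 ≤ a i)
    (hb : ∀ j, 0 ≤ b j) {M : ℝ} (hM : 0 ≤ M) {f : ι × κ → E}
    (hf : ∀ i j, ‖f (i, j)‖ ≤ M * (a i * b j)) :
    lpNorm p f ≤ M * (lpNorm p a * lpNorm p b) := by
  by_cases hptop : p = ∞
  · subst hptop
    have hnn : 0 ≤ M * (lpNorm ∞ a * lpNorm ∞ b) :=
      mul_nonneg hM (mul_nonneg (lpNorm_nonneg _ _) (lpNorm_nonneg _ _))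
    conv_lhs => rw [lpNorm, if_pos rfl]
    refine Real.iSup_le (fun ij => (hf ij.1 ij.2).trans ?_) hnn
    gcongr
    · exact hb _
    · exact lpNorm_nonneg _ _
    · exact (le_abs_self _).trans (norm_le_lpNorm hp a _)
    · exact (le_abs_self _).trans (norm_le_lpNorm hp b _)
  · have hpos : 0 < p.toReal := ENNReal.toReal_pos (zero_lt_one.trans_le hp).ne' hptop
    simp only [lpNorm, hptop, if_false]
    have hsum : ∑ ij, ‖f ij‖ ^ p.toReal ≤
        M ^ p.toReal * ((∑ i, ‖a i‖ ^ p.toReal) * ∑ j, ‖b j‖ ^ p.toReal) := by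
      rw [Fintype.sum_prod_type, Finset.sum_mul_sum, Finset.mul_sum]
      simp only [Finset.mul_sum]
      gcongr with i _ j
      rw [← Real.mul_rpow (norm_nonneg _) (norm_nonneg _),
        ← Real.mul_rpow hM (by positivity), Real.norm_of_nonneg (ha i), Real.norm_of_nonneg (hb j)]
      exact Real.rpow_le_rpow (norm_nonneg _) (hf i j) hpos.le
    refine (Real.rpow_le_rpow (by positivity) hsum (by positivity)).trans_eq ?_
    rw [Real.mul_rpow (by positivity) (by positivity), Real.mul_rpow (by positivity) (by positivity),
      ← Real.rpow_mul hM, mul_one_div_cancel hpos.ne', Real.rpow_one]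

end LpNorm

section Born

open Matrix

variable {p q : ℝ≥0∞}

theorem norm_mul_diagonal_mul_apply_le (hp : 1 ≤ p) (hq : 1 ≤ q) (hpq : 1 / p + 1 / q = 1)
    {ρ σ : Type*} (A : Matrix ρ V ℂ) (η : V → ℂ) (u : Matrix V σ ℂ) (i : ρ) (s : σ) {M : ℝ}
    (hM : 0 ≤ M) (hu : ∀ v, ‖u v s‖ ≤ M) :
    ‖(A * diagonal η * u) i s‖ ≤ lpNorm q (A i) * lpNorm p η * M := by
  rw [mul_apply]
  simp only [mul_diagonal]
  calc _ ≤ ∑ v, ‖A i v‖ * ‖η v‖ * M := by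
        refine norm_sum_le_of_le _ fun v _ => ?_
        rw [norm_mul, norm_mul]
        gcongr
        exact hu v
    _ = (∑ v, ‖A i v‖ * ‖η v‖) * M := by rw [Finset.sum_mul]
    _ ≤ _ := by
        gcongr
        exact sum_norm_mul_norm_le_lpNorm hp hq hpq _ _

theorem norm_list_prod_mul_apply_le (hp : 1 ≤ p) (hq : 1 ≤ q) (hpq : 1 / p + 1 / q = 1)
    {σ : Type*} (G : Matrix V V ℂ) (C : Matrix V σ ℂ) {n : ℕ} (η : Fin n → V → ℂ) (v : V) (s : σ) :
    ‖((List.ofFn fun i => G * diagonal (η i)).prod * C) v s‖ ≤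
      (∏ i, (⨆ w, lpNorm q (G w)) * lpNorm p (η i)) * lpNorm q fun w => C w s := by
  induction n generalizing v with
  | zero => simpa using norm_le_lpNorm hq (fun w => C w s) v
  | succ n ih =>
    rw [List.ofFn_succ, List.prod_cons, Fin.prod_univ_succ, Matrix.mul_assoc]
    have hsup : lpNorm q (G v) ≤ ⨆ w, lpNorm q (G w) :=
      le_ciSup (f := fun w => lpNorm q (G w)) (Set.finite_range _).bddAbove v
    have hC : 0 ≤ lpNorm q fun w => C w s := lpNorm_nonneg _ _
    have hη : ∀ i, 0 ≤ lpNorm p (η i) := fun i => lpNorm_nonneg _ _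
    have hG : 0 ≤ ⨆ w, lpNorm q (G w) := Real.iSup_nonneg fun _ => lpNorm_nonneg _ _
    have hM := mul_nonneg (Finset.prod_nonneg fun (i : Fin n) (_ : i ∈ Finset.univ) =>
      mul_nonneg hG (hη i.succ)) hC
    refine (norm_mul_diagonal_mul_apply_le hp hq hpq G (η 0) _ v s hM
      fun w => ih (fun i => η i.succ) w).trans ?_
    rw [mul_assoc (_ * _) (∏ i, _)]
    exact mul_le_mul_of_nonneg_right (mul_le_mul_of_nonneg_right hsup (hη 0)) hM

theorem lpNorm_bornK_succ_le (hp : 1 ≤ p) (hq : 1 ≤ q) (hpq : 1 / p + 1 / q = 1)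
    {α0 : ℝ} (hα0 : 0 ≤ α0) (B : Matrix R V ℂ) (G : Matrix V V ℂ) (C : Matrix V S ℂ)
    (n : ℕ) (η : ℕ → V → ℂ) :
    lpNorm p (bornK α0 B G C (n + 1) η) ≤
      nuConst α0 p q B C * muConst α0 q G ^ n * ∏ i : Fin (n + 1), lpNorm p (η i) := by
  have hG : 0 ≤ ⨆ w, lpNorm q (G w) := Real.iSup_nonneg fun _ => lpNorm_nonneg _ _
  have hη : ∀ i, 0 ≤ lpNorm p (η i) := fun i => lpNorm_nonneg _ _
  refine (lpNorm_prod_le hp (a := fun r => lpNorm q (B r)) (b := fun s => lpNorm q fun v => C v s)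
    (M := α0 ^ (n + 1) * ((⨆ w, lpNorm q (G w)) ^ n * ∏ i : Fin (n + 1), lpNorm p (η i)))
    (fun _ => lpNorm_nonneg _ _) (fun _ => lpNorm_nonneg _ _)
    (by have := Finset.prod_nonneg fun (i : Fin (n + 1)) (_ : i ∈ Finset.univ) => hη i
        positivity) fun r s => ?_).trans_eq ?_
  · simp only [bornK]
    rw [norm_mul, norm_pow, norm_neg, Complex.norm_real, Real.norm_of_nonneg hα0, mul_assoc]
    refine mul_le_mul_of_nonneg_left ?_ (by positivity)
    rw [Matrix.mul_assoc]
    refine (norm_mul_diagonal_mul_apply_le hp hq hpq B (η 0) _ r s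
      (mul_nonneg (Finset.prod_nonneg fun i _ => mul_nonneg hG (hη _)) (lpNorm_nonneg _ _)) fun v =>
      norm_list_prod_mul_apply_le hp hq hpq G C (fun i : Fin n => η (i + 1)) v s).trans_eq ?_
    rw [Finset.prod_mul_distrib, Fin.prod_univ_succ]
    simp
    ring
  · unfold nuConst muConst
    ring

end Born

section InverseSeries

open Finset Filter Topology FormalMultilinearSeries

theorem sum_Ico_le_of_composition_recursion {u : ℕ → ℝ} (hu : ∀ k, 0 ≤ u k) {x a r h : ℝ}
    (ha : 0 ≤ a) (hr : 0 ≤ r) (hh : 0 ≤ h) (hrh : r * h < 1) (h1 : u 1 ≤ x)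
    (hrec : ∀ n, 2 ≤ n → u n ≤
      a * ∑ c ∈ ({c | 1 < Composition.length c}.toFinset : Finset (Composition n)),
        r ^ c.length * ∏ j, u (c.blocksFun j))
    (hfix : x + a * ((r * h) ^ 2 / (1 - r * h)) ≤ h) (n : ℕ) :
    ∑ k ∈ Ico 1 n, u k ≤ h := by
  induction n with
  | zero => simpa using hh
  | succ n ih =>
    rcases Nat.eq_zero_or_pos n with rfl | hn
    · simpa using hh
    have hS : 0 ≤ ∑ k ∈ Ico 1 n, u k := sum_nonneg fun k _ => hu k
    have hmaj := radius_right_inv_pos_of_radius_pos_aux1 n u hu hr zero_le_one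
    simp only [one_pow, one_mul] at hmaj
    have hpow : ∑ j ∈ Ico 2 (n + 1), r ^ j * (∑ k ∈ Ico 1 n, u k) ^ j ≤
        (r * h) ^ 2 / (1 - r * h) := by
      refine le_trans (sum_le_sum fun j _ => ?_) (geom_sum_Ico_le_of_lt_one (by positivity) hrh)
      rw [mul_pow]
      gcongr
    calc ∑ k ∈ Ico 1 (n + 1), u k = u 1 + ∑ k ∈ Ico 2 (n + 1), u k := by
          rw [sum_eq_sum_Ico_succ_bot (by lia)]
      _ ≤ x + ∑ k ∈ Ico 2 (n + 1),
            a * ∑ c ∈ ({c | 1 < Composition.length c}.toFinset : Finset (Composition k)),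
              r ^ c.length * ∏ j, u (c.blocksFun j) :=
          add_le_add h1 (sum_le_sum fun k hk => hrec k (mem_Ico.1 hk).1)
      _ ≤ x + a * ((r * h) ^ 2 / (1 - r * h)) := by
          rw [← mul_sum]
          gcongr
          exact hmaj.trans hpow
      _ ≤ h := hfix

theorem summable_composition_prod {u : ℕ → ℝ} (hu : ∀ k, 0 ≤ u k) {r h : ℝ}
    (hr : 0 ≤ r) (hrh : r * h < 1) (hsum : ∀ n, ∑ k ∈ Ico 1 n, u k ≤ h) :
    Summable fun c : Σ n, Composition n => r ^ c.2.length * ∏ j, u (c.2.blocksFun j) := by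
  have hh : 0 ≤ h := by simpa using hsum 0
  refine summable_of_sum_le (c := (1 - r * h)⁻¹)
    (fun c => mul_nonneg (pow_nonneg hr _) (prod_nonneg fun _ _ => hu _)) fun s => ?_
  obtain ⟨N, hN⟩ := (tendsto_atTop.1 compPartialSumTarget_tendsto_atTop s).exists
  calc _ ≤ ∑ c ∈ compPartialSumTarget 0 N N, r ^ c.2.length * ∏ j, u (c.2.blocksFun j) :=
        sum_le_sum_of_subset_of_nonneg hN
          fun c _ _ => mul_nonneg (pow_nonneg hr _) (prod_nonneg fun _ _ => hu _)
    _ = ∑ e ∈ compPartialSumSource 0 N N, r ^ e.1 * ∏ j, u (e.2 j) := by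
        symm
        apply compChangeOfVariables_sum
        rintro ⟨k, f⟩ H
        simp only [compChangeOfVariables_length]
        congr 1
        refine Fintype.prod_equiv (finCongr (compChangeOfVariables_length 0 N N H).symm) _ _ ?_
        intro j
        exact congrArg u (compChangeOfVariables_blocksFun 0 N N H j).symm
    _ = ∑ m ∈ Ico 0 N, (r * ∑ k ∈ Ico 1 N, u k) ^ m := by
        rw [compPartialSumSource, sum_sigma]
        refine sum_congr rfl fun m _ => ?_
        dsimp only
        rw [mul_pow, ← mul_sum]
        congr 1
        simpa using (prod_univ_sum (fun _ : Fin m => Ico 1 N) fun _ k => u k).symm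
    _ ≤ ∑ m ∈ Ico 0 N, (r * h) ^ m := by
        gcongr with m
        · exact mul_nonneg hr (sum_nonneg fun _ _ => hu _)
        · exact hsum N
    _ ≤ (1 - r * h)⁻¹ := by
        simpa using geom_sum_Ico_le_of_lt_one (m := 0) (n := N) (by positivity) hrh

variable {E F : Type*} [NormedAddCommGroup E] [NormedSpace ℂ E] [CompleteSpace E]
  [NormedAddCommGroup F] [NormedSpace ℂ F] [CompleteSpace F]

theorem FormalMultilinearSeries.hasSum_leftInv_of_norm_bound
    (P : FormalMultilinearSeries ℂ E F) (i : E ≃L[ℂ] F)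
    (hP0 : P 0 = 0) (hP1 : P 1 = (continuousMultilinearCurryFin1 ℂ E F).symm i)
    {a k r h : ℝ} (ha : 0 ≤ a) (hr : 0 < r) (hh : 0 ≤ h) (hrh : r * h < 1) (hk : 0 ≤ k)
    (hP : ∀ n, ‖P n‖ ≤ a * r ^ n) (hi : ∀ y, ‖i.symm y‖ ≤ k * ‖y‖) (φ : F)
    (hfix : ‖i.symm φ‖ + k * a * ((r * h) ^ 2 / (1 - r * h)) ≤ h) :
    Summable (fun n => ‖P.leftInv i 0 (n + 1) fun _ => φ‖) ∧
      HasSum (fun n => P (n + 1) fun _ => ∑' j, P.leftInv i 0 (j + 1) fun _ => φ) φ := by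
  have hleft : P.leftInv i 0 = P.rightInv i 0 := leftInv_eq_rightInv P i 0 hP1
  set Q := P.leftInv i 0 with hQ
  set u : ℕ → ℝ := fun n => ‖Q n fun _ => φ‖ with hu_def
  have hu : ∀ n, 0 ≤ u n := fun n => norm_nonneg _
  have hcomp : ∀ {n : ℕ} (c : Composition n),
      ‖P.compAlongComposition Q c fun _ => φ‖ ≤
        a * (r ^ c.length * ∏ j, u (c.blocksFun j)) := fun c => by
    rw [compAlongComposition_apply, ← mul_assoc]
    exact (ContinuousMultilinearMap.le_opNorm _ _).trans
      (mul_le_mul_of_nonneg_right (hP _) (prod_nonneg fun _ _ => norm_nonneg _))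
  have hsum : ∀ n, ∑ k ∈ Ico 1 n, u k ≤ h := by
    refine sum_Ico_le_of_composition_recursion hu (mul_nonneg hk ha) hr.le hh hrh
      (x := ‖i.symm φ‖) ?_ (fun n hn => ?_) hfix
    · simp [hu_def, hQ]
    · have hn' := congrArg (fun T => T fun _ => φ) (rightInv_coeff P i 0 n hn)
      rw [← hleft] at hn'
      simp only [hu_def]
      rw [hn']
      simp only [_root_.neg_apply, norm_neg, ContinuousLinearMap.compContinuousMultilinearMap_coe,
        Function.comp_apply, _root_.sum_apply]
      refine (hi _).trans ?_
      rw [mul_assoc]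
      refine mul_le_mul_of_nonneg_left ?_ hk
      rw [mul_sum]
      exact norm_sum_le_of_le _ fun c _ => hcomp c
  have hsummable : Summable fun n => u (n + 1) := by
    refine summable_of_sum_range_le (c := h) (fun n => hu _) fun n => ?_
    simpa [sum_Ico_eq_sum_range, add_comm] using hsum (n + 1)
  refine ⟨hsummable, ?_⟩
  have hη : HasSum (fun j => Q (j + 1) fun _ => φ) (∑' j, Q (j + 1) fun _ => φ) :=
    hsummable.of_norm.hasSum
  set η := ∑' j, Q (j + 1) fun _ => φ
  have hηle : ‖η‖ ≤ h := by
    refine (tsum_of_norm_bounded hsummable.hasSum fun n => le_rfl).trans ?_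
    refine hsummable.tsum_le_of_sum_range_le fun n => ?_
    simpa [sum_Ico_eq_sum_range, add_comm] using hsum (n + 1)
  have hrad : ENNReal.ofReal r⁻¹ ≤ P.radius := by
    refine P.le_radius_of_bound a fun n => ?_
    rw [Real.coe_toNNReal _ (inv_nonneg.2 hr.le), inv_pow]
    exact mul_inv_le_of_le_mul₀ (by positivity) ha (hP n)
  have hηmem : η ∈ Metric.eball (0 : E) P.radius := by
    rw [Metric.mem_eball, edist_zero_right]
    refine lt_of_lt_of_le ?_ hrad
    rw [← ofReal_norm, ENNReal.ofReal_lt_ofReal_iff (by positivity)]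
    refine hηle.trans_lt ?_
    rwa [← one_div, lt_div_iff₀' hr]
  have hball := P.hasFPowerSeriesOnBall ((ENNReal.ofReal_pos.2 (inv_pos.2 hr)).trans_le hrad)
  have htendsto : Tendsto (fun n => ∑ j ∈ Ico 1 n, Q j fun _ => φ) atTop (𝓝 η) := by
    rw [← tendsto_add_atTop_iff_nat 1]
    refine hη.tendsto_sum_nat.congr fun n => ?_
    rw [range_eq_Ico, sum_Ico_add' (fun j => Q j fun _ => φ) 0 n 1, zero_add]
  have hlim : Tendsto (fun n => P.partialSum n (∑ j ∈ Ico 1 n, Q j fun _ => φ)) atTop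
      (𝓝 (P.sum η)) := by
    simpa [Function.comp_def] using (hball.tendsto_partialSum_prod hηmem).comp (tendsto_id.prodMk htendsto)
  have hall : Summable fun c : Σ n, Composition n => P.compAlongComposition Q c.2 fun _ => φ :=
    Summable.of_norm_bounded
      ((summable_composition_prod hu hr.le hrh hsum).mul_left a) fun c => hcomp c.2
  have hPQ : P.comp Q = FormalMultilinearSeries.id ℂ F 0 := by
    rw [hleft, comp_rightInv P i 0 hP1, hP0]
    rfl
  have hval : HasSum (fun c : Σ n, Composition n => P.compAlongComposition Q c.2 fun _ => φ) φ := by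
    have hs := hall.hasSum.sigma (g := fun n => P.comp Q n fun _ => φ) fun n => by
      simp only [FormalMultilinearSeries.comp, _root_.sum_apply]
      exact hasSum_fintype _
    have hone : HasSum (fun n => P.comp Q n fun _ => φ) φ := by
      rw [hPQ]
      convert hasSum_single 1 fun n hn => ?_
      · simp
      · rcases n with - | n
        · simp
        · simp [FormalMultilinearSeries.id_apply_of_one_lt _ _ _ (show 1 < n + 1 by lia)]
    have hsum_eq := hall.hasSum
    rwa [hs.unique hone] at hsum_eq
  have hPη : P.sum η = φ := by
    refine tendsto_nhds_unique hlim ?_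
    simp only [comp_partialSum]
    exact hval.comp compPartialSumTarget_tendsto_atTop
  have hfin := P.hasSum hηmem
  rw [hPη, ← hasSum_nat_add_iff' 1] at hfin
  simpa [hP0] using hfin

end InverseSeries

section BornSeries

open FormalMultilinearSeries

variable {p q : ℝ≥0∞}

/-- The forward Born operators are continuous multilinear maps between `ℓ^p` spaces. -/
theorem exists_bornK_multilinear [Fact (1 ≤ p)] (hq : 1 ≤ q) (hpq : 1 / p + 1 / q = 1)
    {α0 : ℝ} (hα0 : 0 ≤ α0) (B : Matrix R V ℂ) (G : Matrix V V ℂ) (C : Matrix V S ℂ) (n : ℕ) :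
    ∃ f : ContinuousMultilinearMap ℂ
      (fun _ : Fin (n + 1) => PiLp p fun _ : V => ℂ) (PiLp p fun _ : R × S => ℂ),
      (∀ x : ℕ → V → ℂ, (f fun i => WithLp.toLp p (x i)) =
        WithLp.toLp p (bornK α0 B G C (n + 1) x)) ∧
      ‖f‖ ≤ nuConst α0 p q B C * muConst α0 q G ^ n := by
  have hp : 1 ≤ p := Fact.out
  have hmu : 0 ≤ muConst α0 q G :=
    mul_nonneg hα0 (Real.iSup_nonneg fun _ => lpNorm_nonneg _ _)
  have hnu : 0 ≤ nuConst α0 p q B C :=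
    mul_nonneg (mul_nonneg hα0 (lpNorm_nonneg _ _)) (lpNorm_nonneg _ _)
  let diag : (PiLp p fun _ : V => ℂ) →ₗ[ℂ] Matrix V V ℂ :=
    Matrix.diagonalLinearMap V ℂ ℂ ∘ₗ (WithLp.linearEquiv p ℂ (V → ℂ)).toLinearMap
  let factor : Fin (n + 1) → (PiLp p fun _ : V => ℂ) →ₗ[ℂ] Matrix V V ℂ :=
    Fin.cons diag fun _ => LinearMap.mulLeft ℂ G ∘ₗ diag
  let outer : Matrix V V ℂ →ₗ[ℂ] PiLp p fun _ : R × S => ℂ :=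
    { toFun := fun M => WithLp.toLp p fun rs => (-(α0 : ℂ)) ^ (n + 1) * (B * M * C) rs.1 rs.2
      map_add' := fun M N => by
        ext rs
        simp [Matrix.mul_add, Matrix.add_mul, mul_add]
      map_smul' := fun c M => by
        ext rs
        simp [mul_left_comm] }
  obtain ⟨f, hf⟩ : ∃ f : MultilinearMap ℂ
      (fun _ : Fin (n + 1) => PiLp p fun _ : V => ℂ) (PiLp p fun _ : R × S => ℂ),
      ∀ x : ℕ → V → ℂ, (f fun i => WithLp.toLp p (x i)) =
        WithLp.toLp p (bornK α0 B G C (n + 1) x) := by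
    refine ⟨outer.compMultilinearMap
      ((MultilinearMap.mkPiAlgebraFin ℂ (n + 1) (Matrix V V ℂ)).compLinearMap factor),
      fun x => ?_⟩
    simp [outer, factor, diag, bornK, List.ofFn_succ, Matrix.mul_assoc, Matrix.diagonalLinearMap]
  have hbound : ∀ m : Fin (n + 1) → PiLp p fun _ : V => ℂ,
      ‖f m‖ ≤ nuConst α0 p q B C * muConst α0 q G ^ n * ∏ i, ‖m i‖ := fun m => by
    let x : ℕ → V → ℂ := fun k => if h : k < n + 1 then WithLp.ofLp (m ⟨k, h⟩) else 0
    have hm : m = fun i : Fin (n + 1) => WithLp.toLp p (x i) := by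
      funext i
      simp [x, i.is_le]
    have hx := lpNorm_bornK_succ_le hp hq hpq hα0 B G C n x
    simp only [lpNorm_eq_norm_toLp hp] at hx
    rw [hm, hf]
    exact hx
  exact ⟨f.mkContinuous _ hbound, hf, f.mkContinuous_norm_le (by positivity) hbound⟩

/-- The forward Born operators assemble into a formal multilinear series between `ℓ^p` spaces. -/
theorem exists_bornSeries [Fact (1 ≤ p)] (hq : 1 ≤ q) (hpq : 1 / p + 1 / q = 1)
    {α0 : ℝ} (hα0 : 0 ≤ α0) (B : Matrix R V ℂ) (G : Matrix V V ℂ) (C : Matrix V S ℂ) :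
    ∃ P : FormalMultilinearSeries ℂ (PiLp p fun _ : V => ℂ) (PiLp p fun _ : R × S => ℂ),
      (∀ n (x : ℕ → V → ℂ),
        (P n fun i : Fin n => WithLp.toLp p (x i)) = WithLp.toLp p (bornK α0 B G C n x)) ∧
      P 0 = 0 ∧ ∀ n, ‖P (n + 1)‖ ≤ nuConst α0 p q B C * muConst α0 q G ^ n := by
  choose f hf hfnorm using exists_bornK_multilinear (p := p) hq hpq hα0 B G C
  obtain ⟨P, hP0, hPsucc⟩ :
      ∃ P : FormalMultilinearSeries ℂ (PiLp p fun _ : V => ℂ) (PiLp p fun _ : R × S => ℂ),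
        P 0 = 0 ∧ ∀ n, P (n + 1) = f n :=
    ⟨Nat.rec 0 fun n _ => f n, rfl, fun _ => rfl⟩
  refine ⟨P, fun n x => ?_, hP0, fun n => (congrArg norm (hPsucc n)).trans_le (hfnorm n)⟩
  cases n with
  | zero =>
    rw [hP0]
    simp [bornK]
  | succ n =>
    rw [hPsucc]
    exact hf n x

/-- The inverse Born operators are the coefficients of the left inverse of the Born series. -/
theorem leftInv_eq_bornKinv [Fact (1 ≤ p)] {α0 : ℝ} {B : Matrix R V ℂ} {G : Matrix V V ℂ}
    {C : Matrix V S ℂ} {K1inv : (R × S → ℂ) → V → ℂ}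
    {P : FormalMultilinearSeries ℂ (PiLp p fun _ : V => ℂ) (PiLp p fun _ : R × S => ℂ)}
    (hP : ∀ n (x : ℕ → V → ℂ),
      (P n fun i : Fin n => WithLp.toLp p (x i)) = WithLp.toLp p (bornK α0 B G C n x))
    (i : (PiLp p fun _ : V => ℂ) ≃L[ℂ] PiLp p fun _ : R × S => ℂ)
    (hi : ∀ y, i.symm (WithLp.toLp p y) = WithLp.toLp p (K1inv y)) (n : ℕ) (x : ℕ → R × S → ℂ) :
    (P.leftInv i 0 n fun k : Fin n => WithLp.toLp p (x k)) =
      WithLp.toLp p (bornKinv α0 B G C K1inv n x) := by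
  induction n using Nat.strong_induction_on generalizing x with
  | _ n ih =>
    match n, ih with
    | 0, _ =>
      rw [bornKinv]
      simp
    | 1, _ =>
      rw [bornKinv]
      simp [hi]
    | n + 2, ih =>
      rw [bornKinv, leftInv]
      simp only [_root_.neg_apply, _root_.sum_apply, WithLp.toLp_neg, WithLp.toLp_sum, neg_inj]
      rw [← Finset.sum_filter_of_ne (p := fun c : Composition (n + 2) => c.length < n + 2)
        fun c _ hc => by by_contra hlt; simp [hlt] at hc]
      rw [Finset.sum_subtype _ (p := fun c : Composition (n + 2) => c.length < n + 2)
        fun c => by simp]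
      refine Finset.sum_congr rfl fun c _ => ?_
      rw [dif_pos c.2, ← ih _ c.2, ContinuousMultilinearMap.compAlongComposition_apply]
      congr 1
      funext k
      simp only [applyComposition, blockK, k.2, dif_pos, ← hP]
      simp [Function.comp_def, hi]

end BornSeries

theorem majorant_fixed_point_le {mu b x : ℝ} (hmu : 0 < mu) (hb : 0 < b)
    (hx : x ≤ 1 / mu * (1 - 2 * b * (Real.sqrt (1 + b⁻¹) - 1))) :
    ∃ h, 0 ≤ h ∧ mu * h < 1 ∧ x + b / mu * ((mu * h) ^ 2 / (1 - mu * h)) ≤ h := by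
  set w := Real.sqrt (1 + b⁻¹) with hw
  have hwsq : w ^ 2 = 1 + b⁻¹ := Real.sq_sqrt (by positivity)
  have hw1 : 1 ≤ w := by
    rw [hw, Real.one_le_sqrt]
    have := inv_pos.2 hb
    linarith
  have hw0 : 0 < w := by linarith
  have hbw : b * (w ^ 2 - 1) = 1 := by
    rw [hwsq]
    field_simp
    ring
  have hcancel : mu * ((1 - w⁻¹) / mu) = 1 - w⁻¹ := by field_simp
  refine ⟨(1 - w⁻¹) / mu, div_nonneg (sub_nonneg.2 (inv_le_one_of_one_le₀ hw1)) hmu.le, ?_, ?_⟩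
  · rw [hcancel]
    linarith [inv_pos.2 hw0]
  · rw [hcancel]
    refine (add_le_add_left hx _).trans_eq ?_
    field_simp
    ring_nf
    linear_combination (-1) * hbw

theorem sInf_norm_sphere_pos {E F : Type*} [NormedAddCommGroup E] [NormedSpace ℂ E] [Nontrivial E]
    [NormedAddCommGroup F] [NormedSpace ℂ F] (i : E ≃L[ℂ] F) :
    0 < sInf ((fun x => ‖i x‖) '' Metric.sphere 0 1) ∧
      ∀ x, sInf ((fun x => ‖i x‖) '' Metric.sphere 0 1) * ‖x‖ ≤ ‖i x‖ := by
  have hpos : 0 < ‖(i.symm : F →L[ℂ] E)‖ := i.norm_symm_pos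
  constructor
  · refine (inv_pos.2 hpos).trans_le (le_csInf ?_ ?_)
    · exact ((NormedSpace.sphere_nonempty (x := (0 : E))).2 zero_le_one).image _
    · rintro _ ⟨x, hx, rfl⟩
      rw [mem_sphere_zero_iff_norm] at hx
      have hle := (i.symm : F →L[ℂ] E).le_opNorm (i x)
      simp only [ContinuousLinearEquiv.coe_coe, ContinuousLinearEquiv.symm_apply_apply, hx] at hle
      rwa [← one_div, div_le_iff₀' hpos]
  · intro x
    rcases eq_or_ne x 0 with rfl | hx
    · simp
    have hx' : 0 < ‖x‖ := norm_pos_iff.2 hx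
    rw [← le_div_iff₀ hx']
    refine csInf_le ⟨0, ?_⟩ ⟨(‖x‖⁻¹ : ℂ) • x, ?_, ?_⟩
    · rintro _ ⟨y, -, rfl⟩
      exact norm_nonneg _
    · simp [norm_smul, hx'.ne']
    · simp [norm_smul, div_eq_inv_mul]

/- STATEMENT 9: If `|V| = |R × S|` and `K_1` is invertible with inverse `𝒦_1`, the inverse
Born series `Σ_{j=1}^∞ 𝒦_j(φ, …, φ)` converges absolutely whenever
`‖𝒦_1 φ‖_p < (1/μ_p)·[1 − (2ν_p/C_p)(√(1 + C_p/ν_p) − 1)]`, and its sum `η` satisfies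
`Σ_{j=1}^∞ K_j(η, …, η) = φ`. -/
theorem inverse_born_series_converges_K1_bound [Nonempty V] [Nonempty R] [Nonempty S]
    (p q : ℝ≥0∞) (hp : 1 ≤ p) (hq : 1 ≤ q) (hpq : 1 / p + 1 / q = 1)
    (α0 : ℝ) (hα0 : 0 < α0) (B : Matrix R V ℂ) (G : Matrix V V ℂ) (C : Matrix V S ℂ)
    (hcard : Fintype.card V = Fintype.card (R × S))
    (K1inv : (R × S → ℂ) → V → ℂ)
    (hleft : ∀ η : V → ℂ, K1inv (bornK α0 B G C 1 fun _ => η) = η)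
    (hright : ∀ φ : R × S → ℂ, bornK α0 B G C 1 (fun _ => K1inv φ) = φ)
    (mu nu Cp : ℝ) (hmu : mu = muConst α0 q G) (hnu : nu = nuConst α0 p q B C)
    (hCp : Cp = CpConst p α0 B G C)
    (φ : R × S → ℂ)
    (hφ : lpNorm p (K1inv φ) < 1 / mu * (1 - 2 * nu / Cp * (Real.sqrt (1 + Cp / nu) - 1))) :
    Summable (fun j : ℕ => lpNorm p (bornKinv α0 B G C K1inv (j + 1) fun _ => φ)) ∧
      (∑' j : ℕ, bornK α0 B G C (j + 1) fun _ =>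
          ∑' j : ℕ, bornKinv α0 B G C K1inv (j + 1) fun _ => φ) = φ := by
  have : Fact (1 ≤ p) := ⟨hp⟩
  obtain ⟨P, hP, hP0, hPnorm⟩ := exists_bornSeries (p := p) hq hpq hα0.le B G C
  rw [← hmu, ← hnu] at hPnorm
  have hlin : ∀ η, continuousMultilinearCurryFin1 ℂ (PiLp p fun _ : V => ℂ)
      (PiLp p fun _ : R × S => ℂ) (P 1) (WithLp.toLp p η) =
      WithLp.toLp p (bornK α0 B G C 1 fun _ => η) := fun η => by
    rw [← hP 1 fun _ => η, continuousMultilinearCurryFin1_apply]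
    congr 1
  obtain ⟨i, hi⟩ : ∃ i : (PiLp p fun _ : V => ℂ) ≃L[ℂ] PiLp p fun _ : R × S => ℂ,
      (i : (PiLp p fun _ : V => ℂ) →L[ℂ] PiLp p fun _ : R × S => ℂ) =
        continuousMultilinearCurryFin1 ℂ (PiLp p fun _ : V => ℂ)
          (PiLp p fun _ : R × S => ℂ) (P 1) := by
    set L := continuousMultilinearCurryFin1 ℂ (PiLp p fun _ : V => ℂ)
      (PiLp p fun _ : R × S => ℂ) (P 1)
    have hbij : Function.Bijective L.toLinearMap := by
      refine Function.bijective_iff_has_inverse.2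
        ⟨fun y => WithLp.toLp p (K1inv (WithLp.ofLp y)), fun x => ?_, fun y => ?_⟩
      · have hx := hlin (WithLp.ofLp x)
        rw [WithLp.toLp_ofLp] at hx
        simp only [ContinuousLinearMap.coe_coe]
        rw [hx, WithLp.ofLp_toLp, hleft, WithLp.toLp_ofLp]
      · simp only [ContinuousLinearMap.coe_coe]
        rw [hlin, hright, WithLp.toLp_ofLp]
    exact ⟨(LinearEquiv.ofBijective L.toLinearMap hbij).toContinuousLinearEquiv, by ext; rfl⟩
  have hi_apply : ∀ η, i (WithLp.toLp p η) = WithLp.toLp p (bornK α0 B G C 1 fun _ => η) :=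
    fun η => by rw [← hlin, ← hi]; rfl
  have hi_symm : ∀ y, i.symm (WithLp.toLp p y) = WithLp.toLp p (K1inv y) := fun y => by
    rw [ContinuousLinearEquiv.symm_apply_eq, hi_apply, hright]
  have hP1 : P 1 = (continuousMultilinearCurryFin1 ℂ (PiLp p fun _ : V => ℂ)
      (PiLp p fun _ : R × S => ℂ)).symm
      (i : (PiLp p fun _ : V => ℂ) →L[ℂ] PiLp p fun _ : R × S => ℂ) := by
    rw [hi, LinearIsometryEquiv.symm_apply_apply]
  have hset : {t : ℝ | ∃ η : V → ℂ, lpNorm p η = 1 ∧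
      t = lpNorm p (bornK α0 B G C 1 fun _ => η)} = (fun x => ‖i x‖) '' Metric.sphere 0 1 := by
    ext t
    simp only [Set.mem_ofPred_eq, Set.mem_image, mem_sphere_zero_iff_norm,
      lpNorm_eq_norm_toLp hp, ← hi_apply]
    exact ⟨fun ⟨η, h1, h2⟩ => ⟨_, h1, h2.symm⟩, fun ⟨x, h1, h2⟩ => ⟨WithLp.ofLp x, h1, h2.symm⟩⟩
  rw [CpConst, hset] at hCp
  obtain ⟨hCp0, hCp_le⟩ := sInf_norm_sphere_pos i
  rw [← hCp] at hCp0 hCp_le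
  have hi_norm : ∀ y, ‖i.symm y‖ ≤ Cp⁻¹ * ‖y‖ := fun y => by
    rw [← div_eq_inv_mul, le_div_iff₀' hCp0]
    simpa using hCp_le (i.symm y)
  have hmu0 : 0 ≤ mu := hmu ▸ mul_nonneg hα0.le (Real.iSup_nonneg fun _ => lpNorm_nonneg _ _)
  have hmu_pos : 0 < mu := by
    refine hmu0.lt_of_ne fun h => ?_
    rw [← h] at hφ
    simp only [div_zero, zero_mul] at hφ
    exact hφ.not_ge (lpNorm_nonneg _ _)
  have hnu_pos : 0 < nu := by
    obtain ⟨x, hx⟩ := exists_ne (0 : PiLp p fun _ : V => ℂ)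
    have h1 := hCp_le x
    have h2 : ‖i x‖ ≤ nu * ‖x‖ := by
      have h3 := (P 1).le_of_opNorm_le (hPnorm 0) fun _ => x
      rw [hP1] at h3
      simpa using h3
    exact hCp0.trans_le (le_of_mul_le_mul_right (h1.trans h2) (norm_pos_iff.2 hx))
  have hφ' : ‖i.symm (WithLp.toLp p φ)‖ ≤
      1 / mu * (1 - 2 * (nu / Cp) * (Real.sqrt (1 + (nu / Cp)⁻¹) - 1)) := by
    rw [hi_symm, ← lpNorm_eq_norm_toLp hp, inv_div, ← mul_div_assoc]
    exact hφ.le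
  obtain ⟨h, hh, hmuh, hfix⟩ := majorant_fixed_point_le hmu_pos (div_pos hnu_pos hCp0) hφ'
  have hPbound : ∀ n, ‖P n‖ ≤ nu / mu * mu ^ n
    | 0 => by
      rw [hP0, norm_zero]
      positivity
    | n + 1 => (hPnorm n).trans_eq (by rw [pow_succ]; field_simp)
  obtain ⟨hsummable, hsum⟩ := P.hasSum_leftInv_of_norm_bound i hP0 hP1 (a := nu / mu) (k := Cp⁻¹)
    (by positivity) hmu_pos hh hmuh (by positivity) hPbound hi_norm (WithLp.toLp p φ)
    (by convert hfix using 3; field_simp)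
  have hinv : ∀ n, (P.leftInv i 0 n fun _ => WithLp.toLp p φ) =
      WithLp.toLp p (bornKinv α0 B G C K1inv n fun _ => φ) :=
    fun n => leftInv_eq_bornKinv hP i hi_symm n fun _ => φ
  simp only [hinv] at hsummable hsum
  refine ⟨by simpa only [lpNorm_eq_norm_toLp hp] using hsummable, ?_⟩
  have hη : (∑' j, WithLp.toLp p (bornKinv α0 B G C K1inv (j + 1) fun _ => φ)) =
      WithLp.toLp p (∑' j, bornKinv α0 B G C K1inv (j + 1) fun _ => φ) :=
    ((PiLp.continuousLinearEquiv p ℂ fun _ : V => ℂ).symm.map_tsum).symm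
  rw [hη] at hsum
  have hborn : ∀ n η, (P n fun _ => WithLp.toLp p η) =
      WithLp.toLp p (bornK α0 B G C n fun _ => η) :=
    fun n η => hP n fun _ => η
  simp only [hborn] at hsum
  exact ((PiLp.continuousLinearEquiv p ℂ fun _ : R × S => ℂ).hasSum'.2 hsum).tsum_eq
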